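/- The kernel of the K-algebra homomorphism θ : K[X₁,X₂,X₃,X₄] → K[s,u,t,v] defined by X₁ ↦ st, X₂ ↦ sv, X₃ ↦ ut, X₄ ↦ uv is the principal ideal generated by X₁X₄ − X₂X₃. -/

import Mathlib

open MvPolynomial

/-- The Segre substitution θ : K[X₁,X₂,X₃,X₄] → K[s,u,t,v],
    X₁ ↦ st, X₂ ↦ sv, X₃ ↦ ut, X₄ ↦ uv.
    In `K[s,u,t,v] = MvPolynomial (Fin 4) K` we use s = X 0, u = X 1, t = X 2, v = X 3. -/
noncomputable def segreTheta (K : Type*) [Field K] :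
    MvPolynomial (Fin 4) K →ₐ[K] MvPolynomial (Fin 4) K :=
  MvPolynomial.aeval
    ![(X 0 : MvPolynomial (Fin 4) K) * X 2, X 0 * X 3, X 1 * X 2, X 1 * X 3]

/-- `θ` sends the monomial with exponents `m` to the monomial whose exponents are the sums of the
rows and columns of the `2 × 2` array `m`. -/
theorem segreTheta_monomial (K : Type*) [Field K] (m : Fin 4 →₀ ℕ) :
    segreTheta K (monomial m 1) =
      monomial (Finsupp.equivFunOnFinite.symm
        ![m 0 + m 1, m 2 + m 3, m 0 + m 2, m 1 + m 3]) 1 := by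
  rw [segreTheta, aeval_monomial, monomial_eq, Finsupp.prod_fintype _ _ (by simp),
    Finsupp.prod_fintype _ _ (by simp)]
  simp only [Fin.prod_univ_four, map_one, one_mul, Finsupp.equivFunOnFinite_symm_apply_apply,
    Matrix.cons_val]
  ring

/-- A monomial with exponents `a, b, c, d` equals its normal form, in which one of the two middle
variables does not occur, as soon as the variables satisfy `x * w = y * z`. -/
theorem segre_normal_form {R : Type*} [CommRing R] {x y z w : R} (h : x * w = y * z)
    (a b c d : ℕ) :
    x ^ min (a + b) (a + c) * y ^ ((a + b) - (a + c)) * z ^ ((a + c) - (a + b)) *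
        w ^ ((c + d) - ((a + c) - (a + b))) =
      x ^ a * y ^ b * z ^ c * w ^ d := by
  have hk (k : ℕ) : x ^ k * w ^ k = y ^ k * z ^ k := by rw [← mul_pow, h, mul_pow]
  rcases le_total b c with hbc | hbc
  · obtain ⟨e, rfl⟩ := Nat.exists_eq_add_of_le hbc
    rw [show min (a + b) (a + (b + e)) = a + b by omega,
      show (a + b) - (a + (b + e)) = 0 by omega, show (a + (b + e)) - (a + b) = e by omega,
      show (b + e + d) - e = b + d by omega]
    linear_combination x ^ a * z ^ e * w ^ d * hk b
  · obtain ⟨e, rfl⟩ := Nat.exists_eq_add_of_le hbc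
    rw [show min (a + (c + e)) (a + c) = a + c by omega,
      show (a + (c + e)) - (a + c) = e by omega, show (a + c) - (a + (c + e)) = 0 by omega,
      show (c + d) - 0 = c + d by omega]
    linear_combination x ^ a * y ^ e * w ^ d * hk c

/-- If `x * w = y * z`, evaluation at `(x, y, z, w)` factors linearly through `θ`. -/
theorem exists_linearMap_comp_segreTheta (K : Type*) [Field K] {R : Type*} [CommRing R]
    [Algebra K R] {x y z w : R} (h : x * w = y * z) :
    ∃ σ : MvPolynomial (Fin 4) K →ₗ[K] R, ∀ p, σ (segreTheta K p) = aeval ![x, y, z, w] p := by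
  let σ : MvPolynomial (Fin 4) K →ₗ[K] R := (basisMonomials (Fin 4) K).constr K fun m =>
    x ^ min (m 0) (m 2) * y ^ (m 0 - m 2) * z ^ (m 2 - m 0) * w ^ (m 1 - (m 2 - m 0))
  have hσ_monomial (m : Fin 4 →₀ ℕ) : σ (monomial m 1) =
      x ^ min (m 0) (m 2) * y ^ (m 0 - m 2) * z ^ (m 2 - m 0) * w ^ (m 1 - (m 2 - m 0)) :=
    (basisMonomials (Fin 4) K).constr_basis K _ m
  have hσ : σ ∘ₗ (segreTheta K).toLinearMap = (aeval ![x, y, z, w]).toLinearMap := by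
    refine (basisMonomials (Fin 4) K).ext fun m => ?_
    simp only [coe_basisMonomials, LinearMap.comp_apply, AlgHom.toLinearMap_apply,
      segreTheta_monomial]
    rw [hσ_monomial, aeval_monomial, Finsupp.prod_fintype _ _ (by simp)]
    simpa [Fin.prod_univ_four] using segre_normal_form h (m 0) (m 1) (m 2) (m 3)
  exact ⟨σ, fun p => LinearMap.congr_fun hσ p⟩

/-- The kernel of θ is the principal ideal generated by X₁X₄ − X₂X₃. -/
theorem segre_ker (K : Type*) [Field K] :
    RingHom.ker (segreTheta K) =
      Ideal.span {(X 0 : MvPolynomial (Fin 4) K) * X 3 - X 1 * X 2} := by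
  set I : Ideal (MvPolynomial (Fin 4) K) := Ideal.span {X 0 * X 3 - X 1 * X 2} with hI
  apply le_antisymm
  · intro p hp
    have hrel : Ideal.Quotient.mkₐ K I (X 0) * Ideal.Quotient.mkₐ K I (X 3) =
        Ideal.Quotient.mkₐ K I (X 1) * Ideal.Quotient.mkₐ K I (X 2) := by
      rw [← map_mul, ← map_mul]
      exact Ideal.Quotient.eq.mpr (Ideal.subset_span rfl)
    obtain ⟨σ, hσ⟩ := exists_linearMap_comp_segreTheta K hrel
    have hmk : aeval ![Ideal.Quotient.mkₐ K I (X 0), Ideal.Quotient.mkₐ K I (X 1),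
        Ideal.Quotient.mkₐ K I (X 2), Ideal.Quotient.mkₐ K I (X 3)] =
          Ideal.Quotient.mkₐ K I := by
      ext i
      fin_cases i <;> simp
    rw [RingHom.mem_ker] at hp
    have := hσ p
    rw [hp, map_zero, hmk] at this
    exact Ideal.Quotient.eq_zero_iff_mem.mp this.symm
  · rw [hI, Ideal.span_singleton_le_iff_mem, RingHom.mem_ker]
    simp only [segreTheta, map_sub, map_mul, aeval_X, Matrix.cons_val]
    ring
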